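/- arXiv:1303.1427 — 6 statements merged into one kernel-verified Lean document; each statement's English description precedes it below -/
import Mathlib

section
/- For every integer n ≥ 1, the constant function Fin n → ℕ with value varphi(n+1) + 1 is 0-generating. (In particular s₋∞(n) ≤ varphi(n+1).) -/
/-- The indicator function `1_i : Fin n → ℕ` of `{i}`. -/
def oneAt {n : ℕ} (i : Fin n) : Fin n → ℕ := fun j => if j = i then 1 else 0

/-- Pointwise sumset `Σ_{j ∈ Fin n} A j` of a family of sets of functions. -/
def sumset {n : ℕ} (A : Fin n → Set (Fin n → ℕ)) : Set (Fin n → ℕ) :=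
  {x | ∃ a : Fin n → Fin n → ℕ, (∀ j, a j ∈ A j) ∧ x = ∑ j, a j}

/-- The strict lower cone `↓ℏ`. -/
def lowerCone {n : ℕ} (h : Fin n → ℕ) : Set (Fin n → ℕ) :=
  {g | ∀ i, g i < h i}

/-- One step of the generation process: `{x - x(i)·1_i : x ∈ ↓ℏ ∩ Σ_j B j}`. -/
def genStep {n : ℕ} (h : Fin n → ℕ) (B : Fin n → Set (Fin n → ℕ)) (i : Fin n) :
    Set (Fin n → ℕ) :=
  {y | ∃ x ∈ lowerCone h ∩ sumset B, y = x - x i • oneAt i}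

/-- The sets `ℏ^{[m]}(i)`. -/
def bracketSet {n : ℕ} (h : Fin n → ℕ) : ℕ → Fin n → Set (Fin n → ℕ)
  | 0 => fun i => {oneAt i}
  | m + 1 => fun i => genStep h (bracketSet h m) i ∪ bracketSet h m i

/-- The sets `ℏ^{⦃m⦄}(i)`. -/
def braceSet {n : ℕ} (h : Fin n → ℕ) : ℕ → Fin n → Set (Fin n → ℕ)
  | 0 => fun i => {oneAt i}
  | m + 1 => genStep h (bracketSet h m)

/-- `ℏ` is `0`-generating if the zero function belongs to `⋃_{i} ⋃_{m} ℏ^{⦃m⦄}(i)`. -/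
def IsZeroGenerating {n : ℕ} (h : Fin n → ℕ) : Prop :=
  ∃ i : Fin n, ∃ m : ℕ, (0 : Fin n → ℕ) ∈ braceSet h m i


/-- `varphi(m) = max_{0 < k < m} Σ_{i=0}^{m-k-1} k^i` (with `varphi(1) = 0`). -/
def varphiN (m : ℕ) : ℕ :=
  (Finset.Ioo 0 m).sup fun k => ∑ i ∈ Finset.range (m - k), k ^ i

lemma bracketSet_mono {n : ℕ} (h : Fin n → ℕ) (i : Fin n) :
    Monotone fun m => bracketSet h m i :=
  monotone_nat_of_le_succ fun _ => Set.subset_union_right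

/-- The union over `m` of the sets `ℏ^{[m]}(i)`. -/
def generated {n : ℕ} (h : Fin n → ℕ) (i : Fin n) : Set (Fin n → ℕ) :=
  ⋃ m, bracketSet h m i

lemma oneAt_mem_generated {n : ℕ} (h : Fin n → ℕ) (i : Fin n) : oneAt i ∈ generated h i :=
  Set.mem_iUnion.2 ⟨0, rfl⟩

lemma genStep_generated_subset {n : ℕ} (h : Fin n → ℕ) (i : Fin n) :
    genStep h (generated h) i ⊆ generated h i := by
  rintro y ⟨x, ⟨hx, a, ha, hxa⟩, hy⟩
  choose m hm using fun j => Set.mem_iUnion.1 (ha j)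
  refine Set.mem_iUnion.2 ⟨Finset.univ.sup m + 1, Or.inl ⟨x, ⟨hx, a, fun j => ?_, hxa⟩, hy⟩⟩
  exact bracketSet_mono h j (Finset.le_sup (f := m) (Finset.mem_univ j)) (hm j)

lemma isZeroGenerating_of_zero_mem_generated {n : ℕ} {h : Fin n → ℕ} {i : Fin n}
    (hz : (0 : Fin n → ℕ) ∈ generated h i) : IsZeroGenerating h := by
  obtain ⟨m, hm⟩ := Set.mem_iUnion.1 hz
  induction m with
  | zero => exact ⟨i, 0, hm⟩
  | succ m ih => exact hm.elim (fun hm => ⟨i, m + 1, hm⟩) ih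

/-- A profile `w` is realized at level `k` if, for every enumeration `pos` of the coordinates,
the function `w ∘ pos` is generated at each of the first `k` coordinates. -/
def IsRealized {n : ℕ} (h : Fin n → ℕ) (k : ℕ) (w : ℕ → ℕ) : Prop :=
  ∀ pos : Fin n → ℕ, Function.Injective pos → (∀ c, pos c < n) →
    ∀ r, pos r < k → (fun c => w (pos c)) ∈ generated h r

lemma IsRealized.mono {n : ℕ} {h : Fin n → ℕ} {k l : ℕ} {w : ℕ → ℕ} (hw : IsRealized h l w)
    (hkl : k ≤ l) : IsRealized h k w :=
  fun pos hinj hlt r hr => hw pos hinj hlt r (hr.trans_le hkl)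

lemma card_filter_lt_of_injective {n k : ℕ} (hk : k ≤ n) {pos : Fin n → ℕ}
    (hinj : Function.Injective pos) (hlt : ∀ c, pos c < n) :
    (Finset.univ.filter fun c => pos c < k).card = k := by
  have himage : Finset.univ.image pos = Finset.range n := by
    refine Finset.eq_of_subset_of_card_le (fun p hp => ?_) ?_
    · obtain ⟨c, -, rfl⟩ := Finset.mem_image.1 hp
      exact Finset.mem_range.2 (hlt c)
    · simp [Finset.card_image_of_injective _ hinj]
  rw [← Finset.card_image_of_injective _ hinj]
  convert Finset.card_range k using 2
  ext p
  simp only [Finset.mem_image, Finset.mem_filter, Finset.mem_univ, true_and, Finset.mem_range]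
  refine ⟨?_, fun hp => ?_⟩
  · rintro ⟨c, hc, rfl⟩
    exact hc
  · obtain ⟨c, -, rfl⟩ := Finset.mem_image.1 (himage ▸ Finset.mem_range.2 (hp.trans_le hk))
    exact ⟨c, hp, rfl⟩

lemma sum_ite_oneAt {n k : ℕ} (hk : k ≤ n) {pos : Fin n → ℕ}
    (hinj : Function.Injective pos) (hlt : ∀ c, pos c < n) (v : Fin n → ℕ) (c : Fin n) :
    (∑ j, if pos j < k then v else oneAt j) c = k * v c + if pos c < k then 0 else 1 := by
  have hsplit : ∀ j, (if pos j < k then v else oneAt j) c =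
      (if pos j < k then v c else 0) + if c = j then (if pos c < k then 0 else 1) else 0 := by
    intro j
    by_cases hj : pos j < k
    · by_cases hcj : c = j
      · subst hcj; simp [hj]
      · simp [hj, hcj]
    · by_cases hcj : c = j
      · subst hcj; simp [hj, oneAt]
      · simp [hj, hcj, oneAt]
  rw [Finset.sum_apply, Finset.sum_congr rfl fun j _ => hsplit j, Finset.sum_add_distrib,
    ← Finset.sum_filter, Finset.sum_const, card_filter_lt_of_injective hk hinj hlt]
  simp

/-- The profile obtained by summing `k` copies of `w` with the remaining indicators and then
moving the last position to the front. -/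
def shiftProfile (k : ℕ) (w : ℕ → ℕ) (p : ℕ) : ℕ :=
  if p ≤ k then 0 else k * w (p - 1) + 1

lemma IsRealized.shiftProfile {n k H : ℕ} {w : ℕ → ℕ}
    (hw : IsRealized (fun _ : Fin n => H + 1) k w) (hk : k < n) (hzero : ∀ p < k, w p = 0)
    (hbound : ∀ p, k ≤ p → p < n → k * w p + 1 ≤ H) :
    IsRealized (fun _ : Fin n => H + 1) (k + 1) (shiftProfile k w) := by
  intro pos hinj hlt r hr
  set pos' : Fin n → ℕ := fun c => if c = r then n - 1 else
    if pos c < pos r then pos c else pos c - 1 with hpos'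
  have hne : ∀ c, c ≠ r → pos c ≠ pos r := fun c hc => hinj.ne hc
  have hlt' : ∀ c, pos' c < n := by
    intro c
    have := hlt c
    simp only [hpos']
    split_ifs <;> omega
  have hinj' : Function.Injective pos' := by
    intro c d hcd
    have hc := hlt c
    have hd := hlt d
    by_cases hcr : c = r <;> by_cases hdr : d = r
    · rw [hcr, hdr]
    · have := hne d hdr
      simp only [hpos', hcr, hdr, if_true, if_false] at hcd
      split_ifs at hcd <;> omega
    · have := hne c hcr
      simp only [hpos', hcr, hdr, if_true, if_false] at hcd
      split_ifs at hcd <;> omega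
    · have := hne d hdr
      have := hne c hcr
      simp only [hpos', hcr, hdr, if_false] at hcd
      apply hinj
      split_ifs at hcd <;> omega
  have hsum := sum_ite_oneAt hk.le hinj' hlt' (fun c => w (pos' c))
  refine genStep_generated_subset _ r ⟨∑ j, if pos' j < k then (fun c => w (pos' c)) else oneAt j,
    ⟨fun c => ?_, _, fun j => ?_, rfl⟩, ?_⟩
  · rw [hsum c]
    by_cases hc : pos' c < k
    · simp [hc, hzero]
    · simpa [hc, Nat.lt_succ_iff] using hbound _ (not_lt.1 hc) (hlt' c)
  · split_ifs with hj
    · exact hw pos' hinj' hlt' j hj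
    · exact oneAt_mem_generated _ j
  · funext c
    rw [Pi.sub_apply, Pi.smul_apply, hsum c, hsum r]
    by_cases hcr : c = r
    · subst hcr
      have : pos c ≤ k := by omega
      simp [_root_.shiftProfile, oneAt, this]
    · have := hne c hcr
      by_cases hc : pos c ≤ k
      · have hck : pos' c < k := by
          simp only [hpos', hcr, if_false]
          split_ifs <;> omega
        simp [_root_.shiftProfile, hc, hck, hzero _ hck]
      · have hck : pos' c = pos c - 1 := by
          simp only [hpos', hcr, if_false]
          split_ifs <;> omega
        have : ¬ pos c - 1 < k := by omega
        simp [_root_.shiftProfile, oneAt, hc, hcr, hck, this]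

lemma geom_sum_le_varphiN {n k : ℕ} (hk : 1 ≤ k) (hkn : k ≤ n) :
    ∑ i ∈ Finset.range (n + 1 - k), k ^ i ≤ varphiN (n + 1) :=
  Finset.le_sup (f := fun k => ∑ i ∈ Finset.range (n + 1 - k), k ^ i)
    (Finset.mem_Ioo.2 ⟨by omega, by omega⟩)

lemma one_le_varphiN_succ {n : ℕ} (hn : 1 ≤ n) : 1 ≤ varphiN (n + 1) :=
  le_trans (by simp [hn]) (geom_sum_le_varphiN le_rfl hn)

lemma exists_isRealized_shift {n k : ℕ} (hk : 1 ≤ k) (hkn : k < n) {w : ℕ → ℕ}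
    (hw : IsRealized (fun _ : Fin n => varphiN (n + 1) + 1) k w) (hzero : ∀ p < k, w p = 0)
    (hle : ∀ j, k + j < n → w (k + j) ≤ ∑ i ∈ Finset.range (j + 1), k ^ i) (s : ℕ) :
    ∃ v, IsRealized (fun _ : Fin n => varphiN (n + 1) + 1) (k + 1) v ∧ (∀ p < k + 1, v p = 0) ∧
      (∀ j, k + j < n → v (k + j) ≤ ∑ i ∈ Finset.range (j + 1), k ^ i) ∧
      ∀ j ≤ s, k + j < n → v (k + j) ≤ ∑ i ∈ Finset.range j, k ^ i := by
  have hstep : ∀ u : ℕ → ℕ, IsRealized (fun _ : Fin n => varphiN (n + 1) + 1) k u →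
      (∀ p < k, u p = 0) →
      (∀ j, k + j < n → u (k + j) ≤ ∑ i ∈ Finset.range (j + 1), k ^ i) →
      IsRealized (fun _ : Fin n => varphiN (n + 1) + 1) (k + 1) (shiftProfile k u) := by
    intro u hu hzero hle
    refine hu.shiftProfile hkn hzero fun p hkp hpn => ?_
    obtain ⟨j, rfl⟩ := Nat.exists_eq_add_of_le hkp
    calc k * u (k + j) + 1 ≤ k * ∑ i ∈ Finset.range (j + 1), k ^ i + 1 := by
          gcongr
          exact hle j hpn
      _ = ∑ i ∈ Finset.range (j + 1 + 1), k ^ i := geom_sum_succ.symm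
      _ ≤ ∑ i ∈ Finset.range (n + 1 - k), k ^ i :=
          Finset.sum_le_sum_of_subset (Finset.range_subset_range.2 (by omega))
      _ ≤ varphiN (n + 1) := geom_sum_le_varphiN hk hkn.le
  have hfront : ∀ u : ℕ → ℕ, ∀ p < k + 1, shiftProfile k u p = 0 := fun u p hp =>
    if_pos (Nat.lt_succ_iff.1 hp)
  have hsucc : ∀ (u : ℕ → ℕ) (j m : ℕ), u (k + j) ≤ ∑ i ∈ Finset.range m, k ^ i →
      shiftProfile k u (k + (j + 1)) ≤ ∑ i ∈ Finset.range (m + 1), k ^ i := by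
    intro u j m hu
    rw [geom_sum_succ, shiftProfile, if_neg (by omega), ← add_assoc, Nat.add_sub_cancel]
    gcongr
  have hgrow : ∀ u : ℕ → ℕ,
      (∀ j, k + j < n → u (k + j) ≤ ∑ i ∈ Finset.range (j + 1), k ^ i) →
      ∀ j, k + j < n → shiftProfile k u (k + j) ≤ ∑ i ∈ Finset.range (j + 1), k ^ i := by
    rintro u hu (_ | j) hj
    · simp [hfront u k]
    · exact hsucc u j _ (hu j (by omega))
  induction s with
  | zero =>
    refine ⟨shiftProfile k w, hstep w hw hzero hle, hfront w, hgrow w hle, ?_⟩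
    rintro j hj -
    simp [Nat.le_zero.1 hj, hfront w k]
  | succ s ih =>
    obtain ⟨v, hv, hv0, hvle, hvlt⟩ := ih
    refine ⟨shiftProfile k v, hstep v (hv.mono (Nat.le_succ k)) (fun p hp => hv0 p (by omega)) hvle,
      hfront v, hgrow v hvle, ?_⟩
    rintro (_ | j) hjs hj
    · simp [hfront v k]
    · exact hsucc v j _ (hvlt j (by omega) (by omega))

lemma exists_isRealized {n k : ℕ} (hk : 1 ≤ k) (hkn : k ≤ n) :
    ∃ w, IsRealized (fun _ : Fin n => varphiN (n + 1) + 1) k w ∧ (∀ p < k, w p = 0) ∧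
      ∀ j, k + j < n → w (k + j) ≤ ∑ i ∈ Finset.range (j + 1), k ^ i := by
  induction k, hk using Nat.le_induction with
  | base =>
    have h0 : IsRealized (fun _ : Fin n => varphiN (n + 1) + 1) 0 0 :=
      fun _ _ _ _ hr => absurd hr (Nat.not_lt_zero _)
    refine ⟨_, h0.shiftProfile hkn (fun _ _ => rfl) fun _ _ _ => ?_, fun p hp => ?_, fun j _ => ?_⟩
    · simpa using one_le_varphiN_succ hkn
    · exact if_pos (Nat.lt_succ_iff.1 hp)
    · simp [shiftProfile]
  | succ k hk ih =>
    obtain ⟨w, hw, hzero, hle⟩ := ih (by omega)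
    obtain ⟨v, hv, hv0, -, hvlt⟩ := exists_isRealized_shift hk hkn hw hzero hle n
    refine ⟨v, hv, hv0, fun j hj => ?_⟩
    rw [add_assoc, add_comm 1 j] at hj ⊢
    refine (hvlt (j + 1) (by omega) hj).trans (Finset.sum_le_sum fun i _ => ?_)
    gcongr
    omega

/-- For every `n ≥ 1`, the constant function `Fin n → ℕ` with value `varphi(n+1) + 1`
is `0`-generating (hence `s₋∞(n) ≤ varphi(n+1)`). -/
theorem const_varphi_succ_add_one_zero_generating (n : ℕ) (hn : 1 ≤ n) :
    IsZeroGenerating (fun _ : Fin n => varphiN (n + 1) + 1) := by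
  obtain ⟨w, hw, hzero, -⟩ := exists_isRealized hn le_rfl
  refine isZeroGenerating_of_zero_mem_generated (i := ⟨0, hn⟩) ?_
  convert hw Fin.val Fin.val_injective Fin.is_lt ⟨0, hn⟩ hn using 1
  funext c
  exact (hzero c c.is_lt).symm
end

section
/- For every integer n ≥ 2, the constant function Fin n → ℕ with value 1 + ⌊φ(n)⌋ is not 0-generating. (In particular s₋∞(n) > φ(n).) -/
/-- `φ(m) = sup_{1 < x < m} (x^{m-x} - 1)/(x - 1)` (with `φ(1) = 0`, as the set is empty). -/
noncomputable def phiR (m : ℕ) : ℝ :=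
  sSup ((fun x : ℝ => (x ^ ((m : ℝ) - x) - 1) / (x - 1)) '' Set.Ioo 1 (m : ℝ))

/-- The weight of the position `p`: it grows geometrically with ratio `r` and is constant from
position `m` on. -/
noncomputable def cappedPow (r : ℝ) (m p : ℕ) : ℝ := r ^ min p m

lemma cappedPow_pos {r : ℝ} (hr : 1 ≤ r) (m p : ℕ) : 0 < cappedPow r m p := by
  unfold cappedPow; positivity

lemma cappedPow_le_pow {r : ℝ} (hr : 1 ≤ r) (m p : ℕ) : cappedPow r m p ≤ r ^ m :=
  pow_le_pow_right₀ hr (min_le_right _ _)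

lemma cappedPow_le_mul {r : ℝ} (hr : 1 ≤ r) (m : ℕ) {p q : ℕ} (h : p ≤ q + 1) :
    cappedPow r m p ≤ r * cappedPow r m q := by
  unfold cappedPow
  rw [← pow_succ']
  exact pow_le_pow_right₀ hr (by omega)

lemma sum_cappedPow (r : ℝ) (k m : ℕ) :
    ∑ p ∈ Finset.range (m + k), cappedPow r m p = ∑ p ∈ Finset.range m, r ^ p + k * r ^ m := by
  rw [Finset.sum_range_add]
  congr 1
  · refine Finset.sum_congr rfl fun p hp => ?_
    rw [cappedPow, min_eq_left (Finset.mem_range.1 hp).le]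
  · simp [cappedPow]

/-- The functions `a` whose weighted sum, for every arrangement `σ` of the points in the positions
with weights `v`, is at least the weight of `j`. -/
def heavySet {n : ℕ} (v : ℕ → ℝ) (j : Fin n) : Set (Fin n → ℕ) :=
  {a | ∀ σ : Equiv.Perm (Fin n), v (σ j) ≤ ∑ k, v (σ k) * a k}

lemma oneAt_mem_heavySet {n : ℕ} (v : ℕ → ℝ) (j : Fin n) : oneAt j ∈ heavySet v j := by
  intro σ
  simp [oneAt]

lemma sum_le_of_mem_sumset_heavySet {n : ℕ} {v : ℕ → ℝ} {x : Fin n → ℕ}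
    (hx : x ∈ sumset (heavySet v)) (σ : Equiv.Perm (Fin n)) :
    ∑ p ∈ Finset.range n, v p ≤ ∑ k, v (σ k) * x k := by
  obtain ⟨a, ha, rfl⟩ := hx
  rw [← Fin.sum_univ_eq_sum_range, ← Equiv.sum_comp σ fun p : Fin n => v p]
  refine (Finset.sum_le_sum fun j _ => ha j σ).trans_eq ?_
  rw [Finset.sum_comm]
  simp [Finset.mul_sum]

lemma cycleRange_val_le {n : ℕ} (p q : Fin n) : (p.cycleRange q : ℕ) ≤ q + 1 := by
  rcases lt_trichotomy q p with h | rfl | h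
  · rw [Fin.coe_cycleRange_of_lt h]
  · rw [Fin.coe_cycleRange_of_le le_rfl]; simp
  · rw [Fin.cycleRange_of_gt h]; omega

lemma genStep_heavySet_subset {n k m M : ℕ} {r : ℝ} (hr : 1 ≤ r) (hn : m + k = n)
    (hM : M ≤ ∑ p ∈ Finset.range m, r ^ p + (k - r) * r ^ m) (i : Fin n) :
    genStep (fun _ => 1 + M) (heavySet (cappedPow r m)) i ⊆ heavySet (cappedPow r m) i := by
  rintro _ ⟨x, ⟨hxM, hx⟩, rfl⟩ σ
  have hxi : (x i : ℝ) ≤ M := by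
    have h : x i < 1 + M := hxM i
    exact_mod_cast (by omega : x i ≤ M)
  have hsum := sum_le_of_mem_sumset_heavySet hx (σ.trans (σ i).cycleRange)
  rw [show Finset.range n = Finset.range (m + k) by rw [hn], sum_cappedPow] at hsum
  have hzero : (((σ i).cycleRange (σ i) : Fin n) : ℕ) = 0 := by
    rw [Fin.coe_cycleRange_of_le le_rfl]; simp
  rw [← Finset.add_sum_erase _ _ (Finset.mem_univ i)] at hsum ⊢
  simp only [Equiv.trans_apply, hzero] at hsum
  have hone : cappedPow r m 0 = 1 := by simp [cappedPow]
  rw [hone, one_mul] at hsum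
  have hshift : ∑ j ∈ Finset.univ.erase i, cappedPow r m ((σ i).cycleRange (σ j)) * x j ≤
      r * ∑ j ∈ Finset.univ.erase i,
        cappedPow r m (σ j) * ((x - x i • oneAt i : Fin n → ℕ) j : ℝ) := by
    rw [Finset.mul_sum]
    refine Finset.sum_le_sum fun j hj => ?_
    have hj' : (x - x i • oneAt i : Fin n → ℕ) j = x j := by
      simp [oneAt, Finset.ne_of_mem_erase hj]
    rw [hj', ← mul_assoc]
    exact mul_le_mul_of_nonneg_right (cappedPow_le_mul hr m (cycleRange_val_le _ _))
      (Nat.cast_nonneg _)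
  have hi : (x - x i • oneAt i : Fin n → ℕ) i = 0 := by simp [oneAt]
  rw [hi, Nat.cast_zero, mul_zero, zero_add]
  refine (cappedPow_le_pow hr m _).trans (le_of_mul_le_mul_left ?_ (by linarith : 0 < r))
  linarith

lemma genStep_mono {n : ℕ} (h : Fin n → ℕ) {A B : Fin n → Set (Fin n → ℕ)}
    (hAB : ∀ j, A j ⊆ B j) (i : Fin n) : genStep h A i ⊆ genStep h B i := by
  rintro _ ⟨x, ⟨hx, a, ha, rfl⟩, rfl⟩
  exact ⟨_, ⟨hx, a, fun j => hAB j (ha j), rfl⟩, rfl⟩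

lemma bracketSet_subset {n : ℕ} {h : Fin n → ℕ} {C : Fin n → Set (Fin n → ℕ)}
    (hone : ∀ j, oneAt j ∈ C j) (hstep : ∀ j, genStep h C j ⊆ C j) (l : ℕ) (j : Fin n) :
    bracketSet h l j ⊆ C j := by
  induction l generalizing j with
  | zero => exact Set.singleton_subset_iff.2 (hone j)
  | succ l ih => exact Set.union_subset ((genStep_mono h ih j).trans (hstep j)) (ih j)

lemma braceSet_subset_bracketSet {n : ℕ} (h : Fin n → ℕ) (l : ℕ) (j : Fin n) :
    braceSet h l j ⊆ bracketSet h l j := by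
  cases l with
  | zero => exact subset_rfl
  | succ l => exact Set.subset_union_left

lemma not_isZeroGenerating_of_le {n k m M : ℕ} {r : ℝ} (hr : 1 ≤ r) (hn : m + k = n)
    (hM : M ≤ ∑ p ∈ Finset.range m, r ^ p + (k - r) * r ^ m) :
    ¬ IsZeroGenerating (fun _ : Fin n => 1 + M) := by
  rintro ⟨i, l, hl⟩
  have h0 := bracketSet_subset (oneAt_mem_heavySet (cappedPow r m))
    (genStep_heavySet_subset hr hn hM) l i (braceSet_subset_bracketSet _ l i hl) 1
  simp only [Pi.zero_apply, Nat.cast_zero, mul_zero, Finset.sum_const_zero] at h0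
  exact h0.not_gt (cappedPow_pos hr _ _)

lemma hasDerivAt_rpow_sub_one (n : ℕ) :
    HasDerivAt (fun x : ℝ => x ^ ((n : ℝ) - x)) (n - 1) 1 := by
  have h := (hasDerivAt_id (1 : ℝ)).rpow ((hasDerivAt_id (1 : ℝ)).const_sub (n : ℝ))
    (by simp)
  simpa using h

/-- The supremum defining `phiR n` is bounded by a value of the continuous extension of the
function to `[1, n]`. -/
lemma exists_phiR_le_dslope {n : ℕ} (hn : 2 ≤ n) :
    ∃ r ∈ Set.Icc (1 : ℝ) n, phiR n ≤ dslope (fun x : ℝ => x ^ ((n : ℝ) - x)) 1 r := by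
  have hn' : (2 : ℝ) ≤ n := by exact_mod_cast hn
  have hcont : ContinuousOn (dslope (fun x : ℝ => x ^ ((n : ℝ) - x)) 1) (Set.Icc 1 n) := by
    intro x hx
    have hx0 : x ≠ 0 := by linarith [hx.1]
    have hx' : ContinuousAt (fun x : ℝ => x ^ ((n : ℝ) - x)) x :=
      continuousAt_id.rpow (continuousAt_const.sub continuousAt_id) (Or.inl hx0)
    by_cases h1 : x = 1
    · subst h1
      exact (continuousAt_dslope_same.2
        (hasDerivAt_rpow_sub_one n).differentiableAt).continuousWithinAt
    · exact ((continuousAt_dslope_of_ne h1).2 hx').continuousWithinAt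
  obtain ⟨r, hr, hmax⟩ := isCompact_Icc.exists_isMaxOn
    (Set.nonempty_Icc.2 (by linarith : (1 : ℝ) ≤ n)) hcont
  refine ⟨r, hr, csSup_le ((Set.nonempty_Ioo.2 (by linarith)).image _) ?_⟩
  rintro _ ⟨x, hx, rfl⟩
  have h := isMaxOn_iff.1 hmax x (Set.Ioo_subset_Icc_self hx)
  rw [dslope_of_ne _ hx.1.ne', slope_def_field, Real.one_rpow] at h
  exact h

/-- The slope of `x ^ (n - x)` between `1` and `r`, rewritten through the integer part of the
exponent and bounded by Bernoulli's inequality. -/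
lemma dslope_le {n k m : ℕ} {r : ℝ} (hr : 1 ≤ r) (hn : m + k = n) (hrk : r ≤ k)
    (hkr : k ≤ r + 1) :
    dslope (fun x : ℝ => x ^ ((n : ℝ) - x)) 1 r ≤
      ∑ p ∈ Finset.range m, r ^ p + (k - r) * r ^ m := by
  rcases hr.eq_or_lt with rfl | hr1
  · rw [dslope_same, (hasDerivAt_rpow_sub_one n).deriv, ← hn]
    simp
    linarith
  · have hr0 : 0 < r := by linarith
    rw [dslope_of_ne _ hr1.ne', slope_def_field, Real.one_rpow, div_le_iff₀ (by linarith),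
      add_mul, geom_sum_mul, ← hn]
    have hexp : ((m + k : ℕ) : ℝ) - r = m + (k - r) := by push_cast; ring
    rw [hexp, Real.rpow_add hr0, Real.rpow_natCast]
    have hb := rpow_one_add_le_one_add_mul_self (s := r - 1) (p := k - r) (by linarith)
      (by linarith) (by linarith)
    rw [add_sub_cancel] at hb
    nlinarith [mul_le_mul_of_nonneg_left hb (pow_pos hr0 m).le]

/-- For every `n ≥ 2`, the constant function `Fin n → ℕ` with value `1 + ⌊φ(n)⌋`
is not `0`-generating (hence `s₋∞(n) > φ(n)`). -/
theorem const_one_add_floor_phi_not_zero_generating (n : ℕ) (hn : 2 ≤ n) :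
    ¬ IsZeroGenerating (fun _ : Fin n => 1 + ⌊phiR n⌋₊) := by
  obtain ⟨r, hr, hphi⟩ := exists_phiR_le_dslope hn
  have hr0 : 0 ≤ r := by linarith [hr.1]
  have hk : ⌈r⌉₊ ≤ n := Nat.ceil_le.2 hr.2
  have hsum : n - ⌈r⌉₊ + ⌈r⌉₊ = n := Nat.sub_add_cancel hk
  have hle := hphi.trans (dslope_le hr.1 hsum (Nat.le_ceil r) (Nat.ceil_lt_add_one hr0).le)
  refine not_isZeroGenerating_of_le hr.1 hsum ?_
  rcases le_total 0 (phiR n) with h | h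
  · exact (Nat.floor_le h).trans hle
  · rw [Nat.floor_of_nonpos h, Nat.cast_zero]
    have := sub_nonneg.2 (Nat.le_ceil r)
    positivity
end

section
/- Let n ≥ 1 be an integer and let w > 0 be the real number with w·exp(w) = n·e. Then the function x ↦ (n − x)·ln x attains its maximum over x > 0 at the point x = n/w, with maximal value n·w − 2n + n/w; that is, for every real x > 0 one has (n − x)·ln x ≤ n·w − 2n + n/w, with equality when x = n/w. -/
/-- Lemma 6.1: for an integer `n ≥ 1` and `w = W(n e)` (i.e. `w > 0` with
`w·exp(w) = n·e`), the function `x ↦ (n - x)·ln x` attains its maximum over `x > 0`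
at `x = n/w`, with maximal value `n·w - 2n + n/w`. -/
theorem max_of_n_sub_x_mul_log (n : ℕ) (hn : 1 ≤ n) (w : ℝ) (hw : 0 < w)
    (hwe : w * Real.exp w = n * Real.exp 1) :
    (∀ x : ℝ, 0 < x → ((n : ℝ) - x) * Real.log x ≤ n * w - 2 * n + n / w) ∧
    ((n : ℝ) - n / w) * Real.log ((n : ℝ) / w) = n * w - 2 * n + n / w := by
  have hdiv : (n : ℝ) / w = Real.exp (w - 1) := by
    rw [Real.exp_sub, div_eq_div_iff hw.ne' (Real.exp_pos 1).ne', ← hwe, mul_comm]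
  have hn_eq : (n : ℝ) = Real.exp (w - 1) * w := (div_eq_iff hw.ne').mp hdiv
  rw [hdiv, Real.log_exp, hn_eq]
  refine ⟨fun x hx => ?_, by ring⟩
  have ha := Real.exp_pos (w - 1)
  obtain ⟨t, ht, rfl⟩ : ∃ t : ℝ, 0 < t ∧ x = Real.exp (w - 1) * t :=
    ⟨x / Real.exp (w - 1), div_pos hx ha, by field_simp⟩
  rw [Real.log_mul ha.ne' ht.ne', Real.log_exp]
  have hupper : w * Real.log t ≤ w * (t - 1) :=
    mul_le_mul_of_nonneg_left (Real.log_le_sub_one_of_pos ht) hw.le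
  have hlower : t - 1 ≤ t * Real.log t := by
    have h := mul_le_mul_of_nonneg_left (Real.one_sub_inv_le_log_of_pos ht) ht.le
    rwa [mul_sub, mul_one, mul_inv_cancel₀ ht.ne'] at h
  have key : (w - t) * (w - 1 + Real.log t) ≤ (w - 1) ^ 2 := by linarith
  linarith [mul_le_mul_of_nonneg_left key ha.le]
end

section
/- Let n ≥ 4 be an integer and let λ be a real number with 1 < λ < n such that φ_n(x) ≤ φ_n(λ) for all real x with 1 < x < n (λ is a maximizer of φ_n on (1,n)). Then λ^{n−λ}·ln(λ)/(λ−1) ≤ (λ^{n−1} − 1)/(λ−1); equivalently λ^{n−λ}·ln(λ) ≤ λ^{n−1} − 1. -/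
/-- The function `φ_n(x) = (x^{n-x} - 1)/(x - 1)`. -/
noncomputable def phiFun (n : ℕ) (x : ℝ) : ℝ :=
  (x ^ ((n : ℝ) - x) - 1) / (x - 1)

/-- The elementary bound `x^{m-x}·ln x ≤ x^{m-1} - 1`, valid for all `x > 1` and `m ≥ 4`. -/
theorem rpow_sub_mul_log_le {m x : ℝ} (hm : 4 ≤ m) (hx : 1 < x) :
    x ^ (m - x) * Real.log x ≤ x ^ (m - 1) - 1 := by
  have hx0 : 0 < x := by linarith
  have ht : 0 < Real.log x := Real.log_pos hx
  have htx : Real.log x ≤ x - 1 := Real.log_le_sub_one_of_pos hx0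
  set t := Real.log x with ht_def
  have ha : 1 + t ^ 2 ≤ x ^ (x - 1) := by
    rw [Real.rpow_def_of_pos hx0, ← ht_def]
    have := Real.add_one_le_exp (t * (x - 1))
    nlinarith
  have hb : 1 + 3 * t ≤ x ^ (m - 1) := by
    rw [Real.rpow_def_of_pos hx0, ← ht_def]
    have := Real.add_one_le_exp (t * (m - 1))
    nlinarith
  have hsplit : x ^ (m - x) * x ^ (x - 1) = x ^ (m - 1) := by
    rw [← Real.rpow_add hx0]
    ring_nf
  have hc : 0 < x ^ (m - x) := Real.rpow_pos_of_pos hx0 _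
  generalize x ^ (x - 1) = a at *
  generalize x ^ (m - 1) = b at *
  generalize x ^ (m - x) = c at *
  have hcb : c * (1 + t ^ 2) ≤ b := hsplit ▸ mul_le_mul_of_nonneg_left ha hc.le
  have hq : 0 < 1 - t + t ^ 2 := by nlinarith [sq_nonneg (t - 1)]
  have hr : 0 < 2 - 3 * t + 3 * t ^ 2 := by nlinarith [sq_nonneg (2 * t - 1)]
  have hbq : (1 + 3 * t) * (1 - t + t ^ 2) ≤ b * (1 - t + t ^ 2) :=
    mul_le_mul_of_nonneg_right hb hq.le
  have hct : c * (1 + t ^ 2) * t ≤ b * t := mul_le_mul_of_nonneg_right hcb ht.le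
  have hp : 0 < 1 + t ^ 2 := by positivity
  refine le_of_mul_le_mul_right ?_ hp
  nlinarith [mul_pos ht hr]

/-- Lemma 5.1: if `n ≥ 4` and `λ ∈ (1, n)` is a maximizer of `φ_n` on `(1, n)`, then
`λ^{n-λ}·ln(λ)/(λ-1) ≤ (λ^{n-1} - 1)/(λ-1)`; equivalently
`λ^{n-λ}·ln(λ) ≤ λ^{n-1} - 1`. -/
theorem c_lambda_le (n : ℕ) (hn : 4 ≤ n) (lam : ℝ) (hlam1 : 1 < lam) (hlamn : lam < n)
    (hmax : ∀ x : ℝ, 1 < x → x < n → phiFun n x ≤ phiFun n lam) :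
    lam ^ ((n : ℝ) - lam) * Real.log lam / (lam - 1) ≤
      (lam ^ ((n : ℝ) - 1) - 1) / (lam - 1) ∧
    lam ^ ((n : ℝ) - lam) * Real.log lam ≤ lam ^ ((n : ℝ) - 1) - 1 := by
  have key := rpow_sub_mul_log_le (m := n) (by exact_mod_cast hn) hlam1
  exact ⟨div_le_div_of_nonneg_right key (by linarith), key⟩
end

section
/- Let n ≥ 4 be an integer, let λ be a real number with 1 < λ < n such that φ_n(x) ≤ φ_n(λ) for all real x with 1 < x < n (λ is a maximizer of φ_n on (1,n)), and set c = λ^{n−λ}·ln(λ)/(λ−1). Then for every real number k with 1 < k < n: (k − λ)·c + (λ^{n−k} − 1)/(λ − 1) ≥ φ(n). -/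
/-- The crucial inequality: if `n ≥ 4`, `λ ∈ (1, n)` is a maximizer of `φ_n` on `(1, n)`,
and `c = λ^{n-λ}·ln(λ)/(λ-1)`, then for every real `k` with `1 < k < n`:
`(k - λ)·c + (λ^{n-k} - 1)/(λ - 1) ≥ φ(n)`. -/
theorem crucial_inequality (n : ℕ) (hn : 4 ≤ n) (lam : ℝ)
    (hlam1 : 1 < lam) (hlamn : lam < n)
    (hmax : ∀ x : ℝ, 1 < x → x < n → phiFun n x ≤ phiFun n lam)
    (c : ℝ) (hc : c = lam ^ ((n : ℝ) - lam) * Real.log lam / (lam - 1))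
    (k : ℝ) (hk1 : 1 < k) (hkn : k < n) :
    phiR n ≤ (k - lam) * c + (lam ^ ((n : ℝ) - k) - 1) / (lam - 1) := by
  have hsup : phiR n ≤ phiFun n lam := by
    refine csSup_le (Set.Nonempty.image _ ⟨lam, hlam1, hlamn⟩) ?_
    rintro _ ⟨x, ⟨hx1, hxn⟩, rfl⟩
    exact hmax x hx1 hxn
  refine hsup.trans ?_
  have hpos : 0 < lam := one_pos.trans hlam1
  have hexp : 1 + (lam - k) * Real.log lam ≤ lam ^ (lam - k) := by
    rw [Real.rpow_def_of_pos hpos]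
    linarith [Real.add_one_le_exp (Real.log lam * (lam - k))]
  have hsplit : lam ^ ((n : ℝ) - k) = lam ^ ((n : ℝ) - lam) * lam ^ (lam - k) := by
    rw [← Real.rpow_add hpos]
    ring_nf
  have htangent := mul_le_mul_of_nonneg_left hexp (Real.rpow_nonneg hpos.le ((n : ℝ) - lam))
  have hrhs : (k - lam) * c + (lam ^ ((n : ℝ) - k) - 1) / (lam - 1) =
      ((k - lam) * (lam ^ ((n : ℝ) - lam) * Real.log lam) + (lam ^ ((n : ℝ) - k) - 1)) /
        (lam - 1) := by
    rw [hc]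
    ring
  rw [hrhs, phiFun, hsplit]
  exact div_le_div_of_nonneg_right (by linarith) (sub_pos.mpr hlam1).le
end

section
/- The sequence φ(n) grows faster than any exponential but slower than the factorials: for every real a > 1, φ(n)/aⁿ tends to infinity as n → ∞, and φ(n)/n! tends to 0 as n → ∞. -/
open Filter Topology

theorem rpow_sub_le_div_four_pow {m : ℕ} (hm : 256 ≤ m) {x : ℝ} (h1 : 1 < x) (hxm : x < m) :
    x ^ ((m : ℝ) - x) ≤ ((m : ℝ) / 4) ^ m := by
  have hm' : (256 : ℝ) ≤ m := by exact_mod_cast hm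
  rcases le_total x ((m : ℝ) / 4) with h | h
  · calc x ^ ((m : ℝ) - x) ≤ x ^ (m : ℝ) :=
          Real.rpow_le_rpow_of_exponent_le h1.le (by linarith)
      _ = x ^ m := Real.rpow_natCast x m
      _ ≤ ((m : ℝ) / 4) ^ m := by gcongr
  · have h4 : (4 : ℝ) ≤ (m : ℝ) ^ (1 / 4 : ℝ) := by
      calc (4 : ℝ) = (256 : ℝ) ^ (1 / 4 : ℝ) := by
            rw [show (256 : ℝ) = 4 ^ (4 : ℝ) by norm_num, ← Real.rpow_mul (by norm_num)]
            norm_num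
        _ ≤ (m : ℝ) ^ (1 / 4 : ℝ) := by gcongr
    have h4m : (4 : ℝ) ^ m ≤ (m : ℝ) ^ ((m : ℝ) / 4) := by
      calc (4 : ℝ) ^ m ≤ ((m : ℝ) ^ (1 / 4 : ℝ)) ^ m := by gcongr
        _ = (m : ℝ) ^ ((m : ℝ) / 4) := by
            rw [← Real.rpow_natCast, ← Real.rpow_mul (by linarith)]
            ring_nf
    calc x ^ ((m : ℝ) - x) ≤ (m : ℝ) ^ ((m : ℝ) - x) :=
          Real.rpow_le_rpow (by linarith) hxm.le (by linarith)
      _ ≤ (m : ℝ) ^ ((m : ℝ) - m / 4) :=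
          Real.rpow_le_rpow_of_exponent_le (by linarith) (by linarith)
      _ = (m : ℝ) ^ m / (m : ℝ) ^ ((m : ℝ) / 4) := by
          rw [Real.rpow_sub (by linarith), Real.rpow_natCast]
      _ ≤ (m : ℝ) ^ m / 4 ^ m := by gcongr
      _ = ((m : ℝ) / 4) ^ m := by rw [div_pow]

theorem rpow_sub_sub_one_div_le {m : ℕ} (hm : 256 ≤ m) {x : ℝ} (h1 : 1 < x) (hxm : x < m) :
    (x ^ ((m : ℝ) - x) - 1) / (x - 1) ≤ ((m : ℝ) / 4) ^ m := by
  have hm' : (256 : ℝ) ≤ m := by exact_mod_cast hm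
  have hpos : 0 < x - 1 := by linarith
  rcases le_total 2 x with h2 | h2
  · have hbound := rpow_sub_le_div_four_pow hm h1 hxm
    have hnn : 0 ≤ ((m : ℝ) / 4) ^ m := by positivity
    rw [div_le_iff₀ hpos]
    nlinarith
  · have hpow : x ^ ((m : ℝ) - x) ≤ x ^ m := by
      rw [← Real.rpow_natCast x m]
      exact Real.rpow_le_rpow_of_exponent_le h1.le (by linarith)
    calc (x ^ ((m : ℝ) - x) - 1) / (x - 1) ≤ (x ^ m - 1) / (x - 1) := by gcongr
      _ = ∑ i ∈ Finset.range m, x ^ i := (geom_sum_eq h1.ne' m).symm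
      _ ≤ ∑ _i ∈ Finset.range m, (2 : ℝ) ^ m := by
          refine Finset.sum_le_sum fun i hi => ?_
          exact (pow_le_pow_left₀ (by linarith) h2 i).trans
            (pow_le_pow_right₀ (by norm_num) (Finset.mem_range.mp hi).le)
      _ = m * (2 : ℝ) ^ m := by simp
      _ ≤ 2 ^ m * 2 ^ m := by
          gcongr
          exact_mod_cast Nat.lt_two_pow_self.le
      _ = 4 ^ m := by rw [← mul_pow]; norm_num
      _ ≤ ((m : ℝ) / 4) ^ m := by
          gcongr
          linarith

theorem phiR_le_div_four_pow {m : ℕ} (hm : 256 ≤ m) : phiR m ≤ ((m : ℝ) / 4) ^ m := by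
  refine Real.sSup_le ?_ (by positivity)
  rintro _ ⟨x, ⟨h1, hxm⟩, rfl⟩
  exact rpow_sub_sub_one_div_le hm h1 hxm

theorem le_phiR {m : ℕ} (hm : 256 ≤ m) {x : ℝ} (h1 : 1 < x) (hxm : x < m) :
    (x ^ ((m : ℝ) - x) - 1) / (x - 1) ≤ phiR m := by
  refine le_csSup ⟨((m : ℝ) / 4) ^ m, ?_⟩ ⟨x, ⟨h1, hxm⟩, rfl⟩
  rintro _ ⟨y, ⟨hy, hym⟩, rfl⟩
  exact rpow_sub_sub_one_div_le hm hy hym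

theorem phiR_nonneg (m : ℕ) : 0 ≤ phiR m := by
  refine Real.sSup_nonneg ?_
  rintro _ ⟨x, ⟨h1, hxm⟩, rfl⟩
  exact div_nonneg (sub_nonneg.mpr (Real.one_le_rpow h1.le (sub_nonneg.mpr hxm.le)))
    (sub_nonneg.mpr h1.le)

theorem tendsto_phiR_div_pow_atTop {a : ℝ} (ha : 1 < a) :
    Tendsto (fun n : ℕ => phiR n / a ^ n) atTop atTop := by
  have hpos : 0 < 2 * a - 1 := by linarith
  have hC : 0 < ((2 * a) ^ (2 * a) * (2 * a - 1))⁻¹ := by positivity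
  have hlim : Tendsto (fun n : ℕ => (2 : ℝ) ^ n * ((2 * a) ^ (2 * a) * (2 * a - 1))⁻¹
      + -(2 * a - 1)⁻¹) atTop atTop :=
    tendsto_atTop_add_const_right _ _
      ((tendsto_pow_atTop_atTop_of_one_lt (by norm_num)).atTop_mul_const hC)
  refine tendsto_atTop_mono' _ ?_ hlim
  filter_upwards [eventually_ge_atTop 256,
    tendsto_natCast_atTop_atTop.eventually_gt_atTop (2 * a)] with n hn hna
  have hpow : 1 ≤ a ^ n := one_le_pow₀ ha.le
  rw [le_div_iff₀ (by positivity)]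
  refine le_trans ?_ (le_phiR hn (by linarith) hna)
  rw [Real.rpow_sub (by positivity), Real.rpow_natCast, mul_pow]
  calc _ = (2 ^ n * a ^ n / (2 * a) ^ (2 * a)) / (2 * a - 1) - a ^ n / (2 * a - 1) := by
        field_simp
        ring
    _ ≤ (2 ^ n * a ^ n / (2 * a) ^ (2 * a)) / (2 * a - 1) - 1 / (2 * a - 1) := by gcongr
    _ = _ := by rw [sub_div]

theorem tendsto_phiR_div_factorial :
    Tendsto (fun n : ℕ => phiR n / (n.factorial : ℝ)) atTop (𝓝 0) := by
  have hlim : Tendsto (fun n : ℕ => (Real.exp 1 / 4) ^ n) atTop (𝓝 0) :=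
    tendsto_pow_atTop_nhds_zero_of_lt_one (by positivity)
      (by linarith [Real.exp_one_lt_d9])
  refine squeeze_zero' (Eventually.of_forall fun n =>
    div_nonneg (phiR_nonneg n) (Nat.cast_nonneg _)) ?_ hlim
  filter_upwards [eventually_ge_atTop 256] with n hn
  calc phiR n / (n.factorial : ℝ) ≤ ((n : ℝ) / 4) ^ n / n.factorial := by
        gcongr
        exact phiR_le_div_four_pow hn
    _ = (n : ℝ) ^ n / n.factorial / 4 ^ n := by rw [div_pow]; ring
    _ ≤ Real.exp n / 4 ^ n := by
        gcongr
        exact Real.pow_div_factorial_le_exp _ (Nat.cast_nonneg n) n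
    _ = (Real.exp 1 / 4) ^ n := by rw [div_pow, ← Real.exp_nat_mul, mul_one]


/-- The sequence `φ(n)` grows faster than any exponential but slower than the
factorials: for every real `a > 1`, `φ(n)/aⁿ → ∞`, and `φ(n)/n! → 0` as `n → ∞`. -/
theorem phi_growth :
    (∀ a : ℝ, 1 < a →
      Filter.Tendsto (fun n : ℕ => phiR n / a ^ n) Filter.atTop Filter.atTop) ∧
    Filter.Tendsto (fun n : ℕ => phiR n / (n.factorial : ℝ)) Filter.atTop (nhds 0) := by
  exact ⟨fun _ ha => tendsto_phiR_div_pow_atTop ha, tendsto_phiR_div_factorial⟩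
end
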